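/- arXiv:1411.6733 — 3 statements merged into one kernel-verified Lean document; each statement's English description precedes it below -/
import Mathlib

section
/- Let G be a finite simple graph with n vertices, minimum degree δ ≥ 1 and maximum degree Δ, and let I^1_{ℒ(𝒬)}(G) = 1 − (n + 2·R_{−1}(G))/n² be the generalized graph entropy of the normalized (signless) Laplacian. Then 1 − 1/n − 1/(nδ) ≤ I^1_{ℒ(𝒬)}(G) ≤ 1 − 1/n − 1/(nΔ), and equality occurs in either bound if and only if G is a regular graph. -/
/-- The degree of a vertex in a simple graph on `Fin n`. -/
noncomputable def deg {n : ℕ} (G : SimpleGraph (Fin n)) (i : Fin n) : ℕ :=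
  letI := Classical.decRel G.Adj
  G.degree i

/-- The minimum degree of a simple graph on `Fin n`. -/
noncomputable def minDeg {n : ℕ} (G : SimpleGraph (Fin n)) : ℕ :=
  letI := Classical.decRel G.Adj
  G.minDegree

/-- The maximum degree of a simple graph on `Fin n`. -/
noncomputable def maxDeg {n : ℕ} (G : SimpleGraph (Fin n)) : ℕ :=
  letI := Classical.decRel G.Adj
  G.maxDegree

/-- The general Randić index with exponent `-1`,
`R₋₁(G) = ∑_{ij ∈ E(G)} 1/(dᵢ dⱼ)` (each edge counted once). -/
noncomputable def randicM1 {n : ℕ} (G : SimpleGraph (Fin n)) : ℝ :=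
  letI := Classical.decRel G.Adj
  (∑ i, ∑ j, if G.Adj i j then 1 / ((deg G i : ℝ) * (deg G j : ℝ)) else 0) / 2

/-- The generalized entropy of the normalized (signless) Laplacian,
`I¹_{ℒ(𝒬)}(G) = 1 - (n + 2R₋₁(G))/n²`. -/
noncomputable def entropyNormLap {n : ℕ} (G : SimpleGraph (Fin n)) : ℝ :=
  1 - ((n : ℝ) + 2 * randicM1 G) / (n : ℝ) ^ 2

section RandicBounds

variable {n : ℕ} (G : SimpleGraph (Fin n))

theorem minDeg_le_deg (i : Fin n) : minDeg G ≤ deg G i := by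
  classical
  exact G.minDegree_le_degree i

theorem deg_le_maxDeg (i : Fin n) : deg G i ≤ maxDeg G := by
  classical
  exact G.degree_le_maxDegree i

theorem pos_of_one_le_minDeg (h : 1 ≤ minDeg G) : 0 < n := by
  rcases Nat.eq_zero_or_pos n with rfl | hn
  · have : minDeg G = 0 := by
      unfold minDeg
      classical exact SimpleGraph.minDegree_of_subsingleton G
    omega
  · exact hn

theorem exists_deg_eq_minDeg (hn : 0 < n) : ∃ i, deg G i = minDeg G := by
  classical
  have : Nonempty (Fin n) := ⟨⟨0, hn⟩⟩
  obtain ⟨i, hi⟩ := @SimpleGraph.exists_minimal_degree_vertex _ G _ (Classical.decRel G.Adj) _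
  exact ⟨i, hi.symm⟩

theorem exists_deg_eq_maxDeg (hn : 0 < n) : ∃ i, deg G i = maxDeg G := by
  classical
  have : Nonempty (Fin n) := ⟨⟨0, hn⟩⟩
  obtain ⟨i, hi⟩ := @SimpleGraph.exists_maximal_degree_vertex _ G _ (Classical.decRel G.Adj) _
  exact ⟨i, hi.symm⟩

open Classical in
/-- The sum of the reciprocal degrees of the neighbours of `j`. -/
noncomputable def nbrInvDegSum (j : Fin n) : ℝ :=
  ∑ i, if G.Adj i j then 1 / (deg G i : ℝ) else 0

open Classical in
theorem sum_adj_const (i : Fin n) (a : ℝ) :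
    (∑ j, if G.Adj i j then a else 0) = deg G i * a := by
  rw [← Finset.sum_filter, Finset.sum_const, nsmul_eq_mul]
  congr 2
  unfold deg
  rw [← SimpleGraph.card_neighborFinset_eq_degree, SimpleGraph.neighborFinset_eq_filter]

theorem nbrInvDegSum_pos (hd : ∀ i, 0 < deg G i) (j : Fin n) : 0 < nbrInvDegSum G j := by
  classical
  obtain ⟨i, hi⟩ := (@SimpleGraph.degree_pos_iff_exists_adj _ G j _).1 (hd j)
  refine Finset.sum_pos' (fun k _ => by split_ifs <;> positivity) ⟨i, Finset.mem_univ i, ?_⟩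
  have : (0 : ℝ) < deg G i := by exact_mod_cast hd i
  rw [if_pos hi.symm]
  positivity

theorem sum_nbrInvDegSum (hd : ∀ i, 0 < deg G i) : ∑ j, nbrInvDegSum G j = n := by
  classical
  unfold nbrInvDegSum
  rw [Finset.sum_comm]
  have h : ∀ i, (∑ j, if G.Adj i j then 1 / (deg G i : ℝ) else 0) = 1 := fun i => by
    have : (deg G i : ℝ) ≠ 0 := by exact_mod_cast (hd i).ne'
    rw [sum_adj_const]
    field_simp
  simp only [h, Finset.sum_const, Finset.card_univ, Fintype.card_fin, nsmul_eq_mul, mul_one]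

theorem two_mul_randicM1 : 2 * randicM1 G = ∑ j, 1 / (deg G j : ℝ) * nbrInvDegSum G j := by
  classical
  unfold randicM1 nbrInvDegSum
  rw [mul_div_cancel₀ _ (two_ne_zero' ℝ), Finset.sum_comm]
  refine Finset.sum_congr rfl fun j _ => ?_
  rw [Finset.mul_sum]
  refine Finset.sum_congr rfl fun i _ => ?_
  by_cases h : G.Adj i j
  · simp only [h, if_true]
    ring
  · simp [h]

theorem entropyNormLap_sub (hn : 0 < n) (hd : ∀ i, 0 < deg G i) (c : ℝ) :
    entropyNormLap G - (1 - 1 / (n : ℝ) - 1 / ((n : ℝ) * c)) =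
      (∑ j, (1 / c - 1 / (deg G j : ℝ)) * nbrInvDegSum G j) / (n : ℝ) ^ 2 := by
  have hn' : (n : ℝ) ≠ 0 := by exact_mod_cast hn.ne'
  simp only [sub_mul, Finset.sum_sub_distrib, ← Finset.mul_sum]
  rw [sum_nbrInvDegSum G hd, ← two_mul_randicM1, entropyNormLap]
  field_simp
  ring

theorem entropyNormLap_lower (hn : 0 < n) {c : ℕ} (hc : 0 < c) (h : ∀ i, c ≤ deg G i) :
    1 - 1 / (n : ℝ) - 1 / ((n : ℝ) * c) ≤ entropyNormLap G ∧
      (entropyNormLap G = 1 - 1 / (n : ℝ) - 1 / ((n : ℝ) * c) ↔ ∀ i, deg G i = c) := by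
  have hd : ∀ i, 0 < deg G i := fun i => hc.trans_le (h i)
  have hn' : (0 : ℝ) < n := by exact_mod_cast hn
  have hc' : (0 : ℝ) < c := by exact_mod_cast hc
  have key := entropyNormLap_sub G hn hd c
  have hterm : ∀ j ∈ Finset.univ,
      0 ≤ (1 / (c : ℝ) - 1 / (deg G j : ℝ)) * nbrInvDegSum G j := fun j _ =>
    mul_nonneg (sub_nonneg.2 (one_div_le_one_div_of_le hc' (by exact_mod_cast h j)))
      (nbrInvDegSum_pos G hd j).le
  refine ⟨sub_nonneg.1 (key ▸ div_nonneg (Finset.sum_nonneg hterm) (by positivity)), ?_⟩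
  rw [← sub_eq_zero, key, div_eq_zero_iff, or_iff_left (by positivity),
    Finset.sum_eq_zero_iff_of_nonneg hterm]
  refine forall_congr' fun j => ?_
  simp [(nbrInvDegSum_pos G hd j).ne', sub_eq_zero, eq_comm]

theorem entropyNormLap_upper (hn : 0 < n) {c : ℕ} (hd : ∀ i, 0 < deg G i)
    (h : ∀ i, deg G i ≤ c) :
    entropyNormLap G ≤ 1 - 1 / (n : ℝ) - 1 / ((n : ℝ) * c) ∧
      (entropyNormLap G = 1 - 1 / (n : ℝ) - 1 / ((n : ℝ) * c) ↔ ∀ i, deg G i = c) := by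
  have hn' : (0 : ℝ) < n := by exact_mod_cast hn
  have key := entropyNormLap_sub G hn hd c
  have hterm : ∀ j ∈ Finset.univ,
      (1 / (c : ℝ) - 1 / (deg G j : ℝ)) * nbrInvDegSum G j ≤ 0 := fun j _ =>
    mul_nonpos_of_nonpos_of_nonneg
      (sub_nonpos.2 (one_div_le_one_div_of_le (by exact_mod_cast hd j) (by exact_mod_cast h j)))
      (nbrInvDegSum_pos G hd j).le
  refine ⟨sub_nonpos.1 (key ▸ div_nonpos_of_nonpos_of_nonneg (Finset.sum_nonpos hterm)
    (by positivity)), ?_⟩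
  rw [← sub_eq_zero, key, div_eq_zero_iff, or_iff_left (by positivity),
    Finset.sum_eq_zero_iff_of_nonpos hterm]
  refine forall_congr' fun j => ?_
  simp [(nbrInvDegSum_pos G hd j).ne', sub_eq_zero, eq_comm]

end RandicBounds

/-- Corollary: for a graph with `n` vertices, minimum degree `δ ≥ 1` and
maximum degree `Δ`,
`1 - 1/n - 1/(nδ) ≤ I¹_{ℒ(𝒬)}(G) ≤ 1 - 1/n - 1/(nΔ)`, and equality occurs in
either bound iff `G` is regular. -/
theorem stmt12 {n δ Δ : ℕ} (G : SimpleGraph (Fin n))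
    (hδ : minDeg G = δ) (hΔ : maxDeg G = Δ) (hδ1 : 1 ≤ δ) :
    (1 - 1 / (n : ℝ) - 1 / ((n : ℝ) * (δ : ℝ)) ≤ entropyNormLap G ∧
     entropyNormLap G ≤ 1 - 1 / (n : ℝ) - 1 / ((n : ℝ) * (Δ : ℝ))) ∧
    (entropyNormLap G = 1 - 1 / (n : ℝ) - 1 / ((n : ℝ) * (δ : ℝ)) ↔
      ∃ d, ∀ v, deg G v = d) ∧
    (entropyNormLap G = 1 - 1 / (n : ℝ) - 1 / ((n : ℝ) * (Δ : ℝ)) ↔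
      ∃ d, ∀ v, deg G v = d) := by
  subst hδ hΔ
  have hn := pos_of_one_le_minDeg G hδ1
  obtain ⟨hlow, hlow_eq⟩ := entropyNormLap_lower G hn hδ1 (minDeg_le_deg G)
  obtain ⟨hup, hup_eq⟩ := entropyNormLap_upper G hn
    (fun i => hδ1.trans (minDeg_le_deg G i)) (deg_le_maxDeg G)
  refine ⟨⟨hlow, hup⟩, hlow_eq.trans ⟨fun h => ⟨_, h⟩, ?_⟩, hup_eq.trans ⟨fun h => ⟨_, h⟩, ?_⟩⟩
  · rintro ⟨d, hd⟩ i
    obtain ⟨k, hk⟩ := exists_deg_eq_minDeg G hn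
    rw [← hk, hd, hd]
  · rintro ⟨d, hd⟩ i
    obtain ⟨k, hk⟩ := exists_deg_eq_maxDeg G hn
    rw [← hk, hd, hd]
end

section
/- Let G be a finite simple graph with n vertices and m edges, m ≥ 1. Then the generalized graph entropy of the incidence matrix, I_I^1(G) = 1 − 2m/IE(G)², satisfies 0 ≤ I_I^1(G) ≤ 1 − 1/n, and the left equality holds if and only if m = 1. -/
open Polynomial

/-- The number of edges of a simple graph on `Fin n`. -/
noncomputable def numEdges {n : ℕ} (G : SimpleGraph (Fin n)) : ℕ :=
  letI := Classical.decRel G.Adj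
  G.edgeFinset.card

/-- The signless Laplacian matrix `Q(G) = D(G) + A(G)`. -/
noncomputable def signlessLap {n : ℕ} (G : SimpleGraph (Fin n)) :
    Matrix (Fin n) (Fin n) ℝ :=
  letI := Classical.decRel G.Adj
  Matrix.diagonal (fun i => (deg G i : ℝ)) + G.adjMatrix ℝ

namespace Finset

theorem sum_sq_add_sum_offDiag {ι : Type*} [DecidableEq ι] (s : Finset ι) (f : ι → ℝ) :
    (∑ i ∈ s, f i) ^ 2 = ∑ i ∈ s, f i ^ 2 + ∑ p ∈ s.offDiag, f p.1 * f p.2 := by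
  rw [sq, sum_mul_sum, ← sum_product', ← diag_union_offDiag, sum_union (disjoint_diag_offDiag s),
    sum_diag]
  simp only [sq]

theorem sum_sq_eq_sq_sum_iff {ι : Type*} [DecidableEq ι] (s : Finset ι) {f : ι → ℝ}
    (hf : ∀ i, 0 ≤ f i) :
    (∑ i ∈ s, f i) ^ 2 = ∑ i ∈ s, f i ^ 2 ↔ ∀ p ∈ s.offDiag, f p.1 * f p.2 = 0 := by
  rw [sum_sq_add_sum_offDiag, add_eq_left,
    sum_eq_zero_iff_of_nonneg fun p _ => mul_nonneg (hf p.1) (hf p.2)]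

end Finset

namespace Matrix

theorem IsHermitian.trace_mul_self_eq_sum_sq {n : Type*} [Fintype n] [DecidableEq n]
    {A : Matrix n n ℝ} (hA : A.IsHermitian) :
    (A * A).trace = ∑ i, hA.eigenvalues i ^ 2 := by
  conv_lhs =>
    rw [hA.spectral_theorem, ← map_mul, Unitary.conjStarAlgAut_apply, trace_mul_comm, ← mul_assoc]
  simp [trace_diagonal, sq]

theorem IsHermitian.sum_comp_eigenvalues {n : Type*} [Fintype n] [DecidableEq n]
    {A : Matrix n n ℝ} (hA : A.IsHermitian) {q : n → ℝ}
    (hq : A.charpoly = ∏ i, (X - C (q i))) (g : ℝ → ℝ) :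
    ∑ i, g (hA.eigenvalues i) = ∑ i, g (q i) := by
  have h : Multiset.map q Finset.univ.val = Multiset.map hA.eigenvalues Finset.univ.val := by
    have hroots : (∏ i, (X - C (q i))).roots = Multiset.map q Finset.univ.val := by
      simpa [Multiset.map_map] using
        roots_multiset_prod_X_sub_C (Multiset.map q Finset.univ.val)
    rw [← hroots, ← hq, hA.roots_charpoly_eq_eigenvalues]
    rfl
  have h₂ := congrArg (fun t => (t.map g).sum) h
  simpa [Multiset.map_map] using h₂.symm

end Matrix

theorem sum_deg {n : ℕ} (G : SimpleGraph (Fin n)) : ∑ i, deg G i = 2 * numEdges G := by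
  classical
  unfold deg numEdges
  convert G.sum_degrees_eq_twice_card_edges

theorem deg_le_numEdges {n : ℕ} (G : SimpleGraph (Fin n)) (i : Fin n) :
    deg G i ≤ numEdges G := by
  classical
  unfold deg numEdges
  convert G.degree_le_card_edgeFinset i

theorem sum_deg_sq_eq_iff {n : ℕ} (G : SimpleGraph (Fin n)) (hG : 1 ≤ numEdges G) :
    (2 * numEdges G) ^ 2 = ∑ i, deg G i ^ 2 + 2 * numEdges G ↔ numEdges G = 1 := by
  have hs := sum_deg G
  have hle := deg_le_numEdges G
  constructor
  · intro h
    have : ∑ i, deg G i ^ 2 ≤ numEdges G * (2 * numEdges G) := by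
      rw [← hs, Finset.mul_sum]
      exact Finset.sum_le_sum fun i _ => by rw [sq]; exact Nat.mul_le_mul_right _ (hle i)
    nlinarith
  · intro h
    have : ∑ i, deg G i ^ 2 = ∑ i, deg G i := Finset.sum_congr rfl fun i _ => by
      have := hle i
      rw [h] at this
      interval_cases deg G i <;> rfl
    rw [this, hs, h]
    rfl

theorem signlessLap_isHermitian {n : ℕ} (G : SimpleGraph (Fin n)) :
    (signlessLap G).IsHermitian := by
  classical
  exact (Matrix.isHermitian_diagonal _).add
    (by simp [Matrix.IsHermitian, Matrix.conjTranspose_eq_transpose_of_trivial])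

theorem trace_signlessLap {n : ℕ} (G : SimpleGraph (Fin n)) :
    (signlessLap G).trace = 2 * numEdges G := by
  classical
  rw [signlessLap, Matrix.trace_add, SimpleGraph.trace_adjMatrix, Matrix.trace_diagonal, add_zero]
  exact_mod_cast sum_deg G

theorem trace_signlessLap_mul_self {n : ℕ} (G : SimpleGraph (Fin n)) :
    (signlessLap G * signlessLap G).trace = ∑ i, (deg G i : ℝ) ^ 2 + 2 * numEdges G := by
  let := Classical.decRel G.Adj
  have h : ∑ i, (G.degree i : ℝ) = 2 * numEdges G := by exact_mod_cast sum_deg G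
  rw [signlessLap, add_mul, mul_add, mul_add]
  simp only [Matrix.trace_add, Matrix.diagonal_mul_diagonal, Matrix.trace_diagonal]
  simp [Matrix.trace, Matrix.diagonal_mul, Matrix.mul_diagonal, -SimpleGraph.adjMatrix_mul_apply,
    -SimpleGraph.mul_adjMatrix_apply, SimpleGraph.adjMatrix_mul_self_apply_self, ← h, sq]

/-- Corollary: for a graph with `n` vertices and `m ≥ 1` edges, with
`q₁, …, qₙ` the eigenvalues of `Q(G)` and `IE(G) = ∑ √qᵢ` the incidence
energy, the generalized entropy of the incidence matrix
`I¹_I(G) = 1 - 2m/IE(G)²` satisfies `0 ≤ I¹_I(G) ≤ 1 - 1/n`, with left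
equality iff `m = 1`. -/
theorem stmt13 {n m : ℕ} (G : SimpleGraph (Fin n)) (hm : 1 ≤ m)
    (hedge : numEdges G = m)
    (q : Fin n → ℝ) (hq0 : ∀ i, 0 ≤ q i)
    (hq : (signlessLap G).charpoly = ∏ i, (X - C (q i))) :
    (0 ≤ 1 - 2 * (m : ℝ) / (∑ i, Real.sqrt (q i)) ^ 2 ∧
     1 - 2 * (m : ℝ) / (∑ i, Real.sqrt (q i)) ^ 2 ≤ 1 - 1 / (n : ℝ)) ∧
    (1 - 2 * (m : ℝ) / (∑ i, Real.sqrt (q i)) ^ 2 = 0 ↔ m = 1) := by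
  subst hedge
  have hA := signlessLap_isHermitian G
  have h₁ : ∑ i, q i = 2 * numEdges G := by
    rw [← trace_signlessLap, hA.trace_eq_sum_eigenvalues]
    exact (hA.sum_comp_eigenvalues hq id).symm
  have h₂ : ∑ i, q i ^ 2 = ∑ i, (deg G i : ℝ) ^ 2 + 2 * numEdges G := by
    rw [← trace_signlessLap_mul_self, hA.trace_mul_self_eq_sum_sq]
    exact (hA.sum_comp_eigenvalues hq (· ^ 2)).symm
  have hs : ∑ i, √(q i) ^ 2 = 2 * numEdges G := by
    rw [← h₁]
    exact Finset.sum_congr rfl fun i _ => Real.sq_sqrt (hq0 i)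
  have hm' : (1 : ℝ) ≤ numEdges G := by exact_mod_cast hm
  have hlow : 2 * (numEdges G : ℝ) ≤ (∑ i, √(q i)) ^ 2 := by
    rw [← hs, Finset.sum_sq_add_sum_offDiag, le_add_iff_nonneg_right]
    exact Finset.sum_nonneg fun p _ => by positivity
  have hpos : 0 < (∑ i, √(q i)) ^ 2 := by linarith
  have hup : (∑ i, √(q i)) ^ 2 ≤ n * (2 * numEdges G) := by
    simpa [hs] using sq_sum_le_card_mul_sum_sq (s := Finset.univ) (f := fun i => √(q i))
  have hn : (0 : ℝ) < n := by
    by_contra! h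
    nlinarith
  refine ⟨⟨sub_nonneg.2 ((div_le_one hpos).2 hlow), sub_le_sub_left ?_ 1⟩, ?_⟩
  · rw [div_le_div_iff₀ hn hpos]
    linarith
  · rw [sub_eq_zero, eq_comm, div_eq_one_iff_eq hpos.ne', ← hs, eq_comm,
      Finset.sum_sq_eq_sq_sum_iff _ fun i => Real.sqrt_nonneg (q i), ← sum_deg_sq_eq_iff G hm]
    have hsqrt : ∀ p : Fin n × Fin n, √(q p.1) * √(q p.2) = 0 ↔ q p.1 * q p.2 = 0 := fun p => by
      simp only [mul_eq_zero, Real.sqrt_eq_zero (hq0 _)]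
    simp only [hsqrt]
    rw [← Finset.sum_sq_eq_sq_sum_iff _ hq0, h₁, h₂]
    norm_cast
end

section
/- Let G be a finite simple graph with n vertices and m edges, m ≥ 1, with no isolated vertices. Then the generalized graph entropy of the Randić matrix satisfies I_R^1(G) ≤ 1 − 1/n, with equality if and only if every vertex of G has degree one. -/
open Polynomial

/-- The Randić matrix: the `(i,j)` entry is `1/√(dᵢdⱼ)` if `i ~ j`, else `0`. -/
noncomputable def randicMatrix {n : ℕ} (G : SimpleGraph (Fin n)) :
    Matrix (Fin n) (Fin n) ℝ :=
  letI := Classical.decRel G.Adj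
  Matrix.of fun i j =>
    if G.Adj i j then 1 / Real.sqrt ((deg G i : ℝ) * (deg G j : ℝ)) else 0

section Randic

open Matrix

theorem Matrix.IsHermitian.mul_self_eq_smul_one_iff {ι : Type*} [Fintype ι] [DecidableEq ι]
    {A : Matrix ι ι ℝ} (hA : A.IsHermitian) (c : ℝ) :
    A * A = c • (1 : Matrix ι ι ℝ) ↔ ∀ i, hA.eigenvalues i ^ 2 = c := by
  set φ := Unitary.conjStarAlgAut ℝ _ hA.eigenvectorUnitary
  have h : A = φ (diagonal hA.eigenvalues) := hA.spectral_theorem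
  have hone : c • (1 : Matrix ι ι ℝ) = φ (diagonal fun _ => c) := by
    rw [← smul_one_eq_diagonal, map_smul, map_one]
  rw [hone]
  conv_lhs => rw [h]
  rw [← map_mul, (EquivLike.injective φ).eq_iff, diagonal_mul_diagonal, diagonal_eq_diagonal_iff]
  simp only [sq]

theorem Matrix.IsHermitian.trace_mul_self_eq {ι : Type*} [Fintype ι] [DecidableEq ι]
    {A : Matrix ι ι ℝ} (hA : A.IsHermitian) :
    (A * A).trace = ∑ i, hA.eigenvalues i ^ 2 := by
  conv_lhs => rw [hA.spectral_theorem]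
  rw [← map_mul, Unitary.conjStarAlgAut_apply, trace_mul_comm, ← mul_assoc]
  simp [trace_diagonal, sq]

theorem Matrix.IsHermitian.sum_comp_eigenvalues_eq {ι : Type*} [Fintype ι] [DecidableEq ι]
    {A : Matrix ι ι ℝ} (hA : A.IsHermitian) {r : ι → ℝ}
    (hr : A.charpoly = ∏ i, (X - C (r i))) (f : ℝ → ℝ) :
    ∑ i, f (hA.eigenvalues i) = ∑ i, f (r i) := by
  have h : Multiset.map hA.eigenvalues Finset.univ.val = Multiset.map r Finset.univ.val := by
    have h₁ := hA.roots_charpoly_eq_eigenvalues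
    rw [hr, Polynomial.roots_prod _ _
      (Finset.prod_ne_zero_iff.2 fun i _ => X_sub_C_ne_zero _)] at h₁
    simpa [Function.comp_def] using h₁.symm
  simpa only [Multiset.map_map, Function.comp_def, Finset.sum] using
    congrArg (fun s => (Multiset.map f s).sum) h

theorem Finset.sum_sub_mean_sq {ι : Type*} [Fintype ι] [Nonempty ι] (f : ι → ℝ) :
    ∑ i, (f i - (∑ j, f j) / Fintype.card ι) ^ 2 =
      ∑ i, f i ^ 2 - (∑ i, f i) ^ 2 / Fintype.card ι := by
  have h : (Fintype.card ι : ℝ) ≠ 0 := by simp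
  simp only [sub_sq, Finset.sum_add_distrib, Finset.sum_sub_distrib, ← Finset.sum_mul,
    ← Finset.mul_sum, Finset.sum_const, Finset.card_univ, nsmul_eq_mul]
  field_simp
  ring

variable {n : ℕ} (G : SimpleGraph (Fin n))

theorem randicMatrix_nonneg (i j : Fin n) : 0 ≤ randicMatrix G i j := by
  classical
  simp only [randicMatrix, of_apply]
  split_ifs <;> positivity

theorem randicMatrix_isHermitian : (randicMatrix G).IsHermitian := by
  ext i j
  by_cases h : G.Adj i j
  · simp [randicMatrix, h, h.symm, mul_comm]
  · simp [randicMatrix, h, mt G.adj_symm h]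

theorem randicMatrix_pos (hiso : ∀ v, 0 < deg G v) {i j : Fin n} (h : G.Adj i j) :
    0 < randicMatrix G i j := by
  have hi : (0 : ℝ) < deg G i := by exact_mod_cast hiso i
  have hj : (0 : ℝ) < deg G j := by exact_mod_cast hiso j
  simp only [randicMatrix, of_apply, if_pos h]
  positivity

theorem randicMatrix_mul_self_pos (hiso : ∀ v, 0 < deg G v) {i j k : Fin n}
    (hij : G.Adj i j) (hjk : G.Adj j k) : 0 < (randicMatrix G * randicMatrix G) i k :=
  Finset.sum_pos' (fun l _ => mul_nonneg (randicMatrix_nonneg G i l) (randicMatrix_nonneg G l k))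
    ⟨j, Finset.mem_univ _, mul_pos (randicMatrix_pos G hiso hij) (randicMatrix_pos G hiso hjk)⟩

theorem exists_adj_of_deg_pos {v : Fin n} (h : 0 < deg G v) : ∃ w, G.Adj v w := by
  classical
  exact (G.degree_pos_iff_exists_adj v).1 h

theorem deg_eq_one_iff {v : Fin n} : deg G v = 1 ↔ ∃! w, G.Adj v w := by
  classical
  exact G.degree_eq_one_iff_existsUnique_adj

theorem trace_randicMatrix_mul_self :
    (randicMatrix G * randicMatrix G).trace = 2 * randicM1 G := by
  classical
  rw [randicM1, mul_div_cancel₀ _ (two_ne_zero' ℝ)]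
  simp only [trace, diag_apply, mul_apply]
  refine Finset.sum_congr rfl fun i _ => Finset.sum_congr rfl fun j _ => ?_
  rw [show randicMatrix G j i = randicMatrix G i j from (randicMatrix_isHermitian G).apply i j]
  simp only [randicMatrix, of_apply]
  split_ifs
  · rw [div_mul_div_comm, Real.mul_self_sqrt (by positivity), one_mul]
  · simp

theorem randicMatrix_mul_self_of_deg_eq_one (h : ∀ v, deg G v = 1) :
    randicMatrix G * randicMatrix G = (1 : ℝ) • (1 : Matrix (Fin n) (Fin n) ℝ) := by
  classical
  ext i k
  obtain ⟨j, hj⟩ := exists_adj_of_deg_pos G (v := i) (by simp [h])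
  have huniq : ∀ {u v w : Fin n}, G.Adj u v → G.Adj u w → v = w := by
    intro u v w hv hw
    exact ((deg_eq_one_iff G).1 (h u)).unique hv hw
  rw [mul_apply, Finset.sum_eq_single j]
  · by_cases hik : i = k
    · subst hik
      simp [randicMatrix, h, hj, hj.symm]
    · have hjk : ¬ G.Adj j k := fun hjk => hik (huniq hj.symm hjk)
      simp [randicMatrix, hjk, hik]
  · intro l _ hl
    have hil : ¬ G.Adj i l := fun hil => hl (huniq hil hj)
    simp [randicMatrix, hil]
  · simp

theorem deg_eq_one_of_randicMatrix_mul_self (hiso : ∀ v, 0 < deg G v) {c : ℝ}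
    (h : randicMatrix G * randicMatrix G = c • (1 : Matrix (Fin n) (Fin n) ℝ)) (v : Fin n) :
    deg G v = 1 := by
  obtain ⟨w, hw⟩ := exists_adj_of_deg_pos G (hiso v)
  refine (deg_eq_one_iff G).2 ⟨w, hw, fun u hu => ?_⟩
  by_contra hne
  have hpos := randicMatrix_mul_self_pos G hiso (G.adj_symm hu) hw
  simp [h, hne] at hpos

end Randic

/-- Corollary: for a graph with `n` vertices, `m ≥ 1` edges and no isolated
vertices, with `ρ₁, …, ρₙ` the eigenvalues of the Randić matrix and
`RE(G) = ∑ |ρᵢ|` the Randić energy, the generalized entropy of the Randić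
matrix `I¹_R(G) = 1 - (2/RE(G)²)·R₋₁(G)` satisfies `I¹_R(G) ≤ 1 - 1/n`, with
equality iff every vertex of `G` has degree one. -/
theorem stmt17 {n m : ℕ} (G : SimpleGraph (Fin n)) (hm : 1 ≤ m)
    (hedge : numEdges G = m) (hiso : ∀ v, 0 < deg G v)
    (ρ : Fin n → ℝ)
    (hρ : (randicMatrix G).charpoly = ∏ i, (X - C (ρ i))) :
    1 - (2 / (∑ i, |ρ i|) ^ 2) * randicM1 G ≤ 1 - 1 / (n : ℝ) ∧
    (1 - (2 / (∑ i, |ρ i|) ^ 2) * randicM1 G = 1 - 1 / (n : ℝ) ↔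
      ∀ v, deg G v = 1) := by
  have hA := randicMatrix_isHermitian G
  obtain ⟨v⟩ : Nonempty (Fin n) := by
    by_contra hempty
    rw [not_nonempty_iff] at hempty
    have : numEdges G = 0 := by simp [numEdges, Subsingleton.elim G ⊥]
    lia
  have hn : (0 : ℝ) < n := by exact_mod_cast v.pos
  have htrace : 2 * randicM1 G = ∑ i, |hA.eigenvalues i| ^ 2 := by
    simp only [sq_abs]
    rw [← trace_randicMatrix_mul_self, hA.trace_mul_self_eq]
  rw [← hA.sum_comp_eigenvalues_eq hρ]
  set S := ∑ i, |hA.eigenvalues i| with hS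
  have hpos : 0 < 2 * randicM1 G := by
    rw [← trace_randicMatrix_mul_self]
    refine Finset.sum_pos (fun i _ => ?_) ⟨v, Finset.mem_univ v⟩
    obtain ⟨w, hw⟩ := exists_adj_of_deg_pos G (hiso i)
    exact randicMatrix_mul_self_pos G hiso hw hw.symm
  have hS0 : 0 < S := by
    refine (Finset.sum_nonneg fun i _ => abs_nonneg _).lt_of_ne fun h0 => ?_
    have hz := (Finset.sum_eq_zero_iff_of_nonneg fun i _ => abs_nonneg (hA.eigenvalues i)).1
      h0.symm
    rw [htrace, Finset.sum_eq_zero fun i hi => by rw [hz i hi]; simp] at hpos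
    exact hpos.false
  have : Nonempty (Fin n) := ⟨v⟩
  have hmean := Finset.sum_sub_mean_sq fun i => |hA.eigenvalues i|
  rw [← htrace, ← hS, Fintype.card_fin] at hmean
  have hdiff : 1 - 1 / (n : ℝ) - (1 - 2 / S ^ 2 * randicM1 G) =
      (∑ i, (|hA.eigenvalues i| - S / n) ^ 2) / S ^ 2 := by
    rw [hmean]
    field_simp
    ring
  refine ⟨sub_nonneg.1 (hdiff ▸ by positivity), ?_⟩
  rw [eq_comm, ← sub_eq_zero, hdiff, div_eq_zero_iff, or_iff_left (by positivity),
    Finset.sum_eq_zero_iff_of_nonneg fun i _ => sq_nonneg _]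
  constructor
  · intro h
    refine deg_eq_one_of_randicMatrix_mul_self G hiso
      ((hA.mul_self_eq_smul_one_iff ((S / n) ^ 2)).2 fun i => ?_)
    have hi := sub_eq_zero.1 (pow_eq_zero_iff two_ne_zero |>.1 (h i (Finset.mem_univ i)))
    rw [← sq_abs, hi]
  · intro h i _
    have habs : ∀ j, |hA.eigenvalues j| = 1 := fun j =>
      (pow_eq_one_iff_of_nonneg (abs_nonneg _) two_ne_zero).1 <| (sq_abs _).trans <|
        (hA.mul_self_eq_smul_one_iff 1).1 (randicMatrix_mul_self_of_deg_eq_one G h) j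
    simp [hS, habs, hn.ne']
end
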